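/- arXiv:math/0407209 — 2 statements merged into one kernel-verified Lean document; each statement's English description precedes it below -/
import Mathlib

section
/- Let C be a category equipped with two closed model structures M₁ and M₂ having the same class of weak equivalences (but possibly different cofibrations and fibrations). Then a commutative square in C with maps A → X, A → B, X → Y, B → Y is homotopy cocartesian with respect to M₁ if and only if it is homotopy cocartesian with respect to M₂. -/
open CategoryTheory CategoryTheory.Limits Opposite

universe w v u

/-- A morphism `f` is a retract of a morphism `g`. -/
def IsRetractOfMaps {C : Type u} [Category.{v} C] {X Y X' Y' : C}
    (f : X ⟶ Y) (g : X' ⟶ Y') : Prop :=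
  ∃ (i : X ⟶ X') (r : X' ⟶ X) (j : Y ⟶ Y') (s : Y' ⟶ Y),
    i ≫ r = 𝟙 X ∧ j ≫ s = 𝟙 Y ∧ i ≫ g = f ≫ j ∧ g ≫ s = r ≫ f

/-- A closed model structure on a category `C`, recorded as the three classes of
weak equivalences, cofibrations, and fibrations, together with Quillen's axioms
CM2 (two-out-of-three), CM3 (retracts), CM4 (lifting), and CM5 (factorization). -/
structure ModelStructure (C : Type u) [Category.{v} C] where
  W : MorphismProperty C
  Cof : MorphismProperty C
  Fib : MorphismProperty C
  W_of_isIso : ∀ {X Y : C} (f : X ⟶ Y), IsIso f → W f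
  W_comp : ∀ {X Y Z : C} (f : X ⟶ Y) (g : Y ⟶ Z), W f → W g → W (f ≫ g)
  W_of_comp_left : ∀ {X Y Z : C} (f : X ⟶ Y) (g : Y ⟶ Z), W f → W (f ≫ g) → W g
  W_of_comp_right : ∀ {X Y Z : C} (f : X ⟶ Y) (g : Y ⟶ Z), W g → W (f ≫ g) → W f
  W_retract : ∀ {X Y X' Y' : C} (f : X ⟶ Y) (g : X' ⟶ Y'),
    IsRetractOfMaps f g → W g → W f
  Cof_retract : ∀ {X Y X' Y' : C} (f : X ⟶ Y) (g : X' ⟶ Y'),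
    IsRetractOfMaps f g → Cof g → Cof f
  Fib_retract : ∀ {X Y X' Y' : C} (f : X ⟶ Y) (g : X' ⟶ Y'),
    IsRetractOfMaps f g → Fib g → Fib f
  lifting : ∀ {A B X Y : C} (i : A ⟶ B) (p : X ⟶ Y),
    Cof i → Fib p → (W i ∨ W p) → HasLiftingProperty i p
  fact_cof_trivFib : ∀ {X Y : C} (f : X ⟶ Y),
    ∃ (Z : C) (i : X ⟶ Z) (p : Z ⟶ Y), Cof i ∧ Fib p ∧ W p ∧ i ≫ p = f
  fact_trivCof_fib : ∀ {X Y : C} (f : X ⟶ Y),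
    ∃ (Z : C) (i : X ⟶ Z) (p : Z ⟶ Y), Cof i ∧ W i ∧ Fib p ∧ i ≫ p = f

variable {C : Type u} [Category.{v} C]

/-- An object is cofibrant when the map from the initial object is a cofibration. -/
def ModelStructure.Cofibrant [HasInitial C] (M : ModelStructure C) (A : C) : Prop :=
  M.Cof (initial.to A)

/-- A commutative square (`f : A ⟶ X`, `g : A ⟶ B`, `g' : X ⟶ Y`, `f' : B ⟶ Y`) is
homotopy cocartesian when it admits a cofibrant replacement by a genuine pushout square:
there are cofibrations `f₀ : A' ⟶ X'`, `g₀ : A' ⟶ B'` with `A'` cofibrant, and weak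
equivalences `A' ⟶ A`, `X' ⟶ X`, `B' ⟶ B` compatible with `f` and `g`, such that the
induced map from the pushout `X' ∪_{A'} B'` to `Y` is a weak equivalence. -/
def IsHomotopyCocartesian [HasInitial C] (M : ModelStructure C)
    {A B X Y : C} (f : A ⟶ X) (g : A ⟶ B) (g' : X ⟶ Y) (f' : B ⟶ Y) : Prop :=
  ∃ (A' X' B' : C) (f₀ : A' ⟶ X') (g₀ : A' ⟶ B')
    (a : A' ⟶ A) (x : X' ⟶ X) (b : B' ⟶ B),
    M.Cofibrant A' ∧ M.Cof f₀ ∧ M.Cof g₀ ∧ M.W a ∧ M.W x ∧ M.W b ∧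
    f₀ ≫ x = a ≫ f ∧ g₀ ≫ b = a ≫ g ∧
    ∃ (P : C) (inl : X' ⟶ P) (inr : B' ⟶ P),
      IsPushout f₀ g₀ inl inr ∧
      ∃ (q : P ⟶ Y), M.W q ∧ inl ≫ q = x ≫ g' ∧ inr ≫ q = b ≫ f'

namespace HomotopicalAlgebra

attribute [local simp] pushout.inl_desc pushout.inl_desc_assoc pushout.inr_desc
  pushout.inr_desc_assoc coprod.inl_desc coprod.inr_desc

section

variable {C : Type*} [Category* C] [ModelCategory C]

lemma exists_cofibration_trivialFibration {X Y : C} (f : X ⟶ Y) :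
    ∃ (Z : C) (i : X ⟶ Z) (p : Z ⟶ Y),
      Cofibration i ∧ Fibration p ∧ WeakEquivalence p ∧ i ≫ p = f :=
  let h := MorphismProperty.factorizationData (cofibrations C) (trivialFibrations C) f
  ⟨h.Z, h.i, h.p, inferInstance, inferInstance, inferInstance, h.fac⟩

lemma exists_trivialCofibration_fibration {X Y : C} (f : X ⟶ Y) :
    ∃ (Z : C) (i : X ⟶ Z) (p : Z ⟶ Y),
      Cofibration i ∧ WeakEquivalence i ∧ Fibration p ∧ i ≫ p = f :=
  let h := MorphismProperty.factorizationData (trivialCofibrations C) (fibrations C) f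
  ⟨h.Z, h.i, h.p, inferInstance, inferInstance, inferInstance, h.fac⟩

section Saturation

variable {H : Type*} [Category* H] (L : C ⥤ H) [L.IsLocalization (weakEquivalences C)]

lemma isIso_map_of_weakEquivalence {X Y : C} (f : X ⟶ Y) [WeakEquivalence f] :
    IsIso (L.map f) :=
  Localization.inverts L (weakEquivalences C) f (mem_weakEquivalences f)

lemma weakEquivalence_of_isIso_map_of_fibration {X Y : C} [IsCofibrant X] [IsFibrant X]
    [IsCofibrant Y] [IsFibrant Y] (p : X ⟶ Y) [Fibration p] [IsIso (L.map p)] :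
    WeakEquivalence p := by
  obtain ⟨s₀, hs₀⟩ := map_surjective_of_isLocalization L Y X (inv (L.map p))
  have h : LeftHomotopyRel (s₀ ≫ p) (𝟙 Y) := by
    rw [LeftHomotopyRel.iff_map_eq L]
    simp [hs₀]
  obtain ⟨P, _, ⟨h⟩⟩ := h.exists_good_cylinder
  obtain ⟨s, h', hs⟩ := h.covering_homotopy p s₀ rfl
  have hsp : s ≫ p = 𝟙 Y := by
    rw [← h'.h₁, Category.assoc, hs, h.h₁]
  have hps : LeftHomotopyRel (p ≫ s) (𝟙 X) := by
    have := (LeftHomotopyRel.iff_map_eq L Y X).1 h'.leftHomotopyRel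
    rw [LeftHomotopyRel.iff_map_eq L, L.map_comp, ← this, hs₀]
    simp
  obtain ⟨Q, ⟨k⟩⟩ := hps
  have hw : WeakEquivalence (p ≫ s) := k.weakEquivalence_iff.2 inferInstance
  rw [weakEquivalence_iff] at hw ⊢
  exact MorphismProperty.of_retract
    { i := Arrow.homMk (𝟙 X) s (by simp)
      r := Arrow.homMk (𝟙 X) p (by simp [hsp])
      retract := by ext <;> simp [hsp] } hw

lemma weakEquivalence_iff_isIso_map {X Y : C} (f : X ⟶ Y) :
    WeakEquivalence f ↔ IsIso (L.map f) := by
  refine ⟨fun _ ↦ isIso_map_of_weakEquivalence L f, fun _ ↦ ?_⟩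
  obtain ⟨X', _, x, _, _, _, _⟩ := exists_cofibration_trivialFibration (initial.to X)
  obtain ⟨Y', f', y, _, _, _, fac⟩ := exists_cofibration_trivialFibration (x ≫ f)
  obtain ⟨Y'', j, _, _, _, _, _⟩ := exists_trivialCofibration_fibration (terminal.from Y')
  obtain ⟨Z, i, p, _, _, _, fac'⟩ := exists_trivialCofibration_fibration (f' ≫ j)
  obtain rfl := Subsingleton.elim (initial.to X') ‹_›
  obtain rfl := Subsingleton.elim (terminal.from Y'') ‹_›
  have : IsCofibrant X' := ‹_›
  have : IsFibrant Y'' := ‹_›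
  have : IsCofibrant Y' := isCofibrant_of_cofibration f'
  have : IsCofibrant Y'' := isCofibrant_of_cofibration j
  have : IsCofibrant Z := isCofibrant_of_cofibration i
  have : IsFibrant Z := isFibrant_of_fibration p
  have := isIso_map_of_weakEquivalence L x
  have := isIso_map_of_weakEquivalence L y
  have := isIso_map_of_weakEquivalence L i
  have := isIso_map_of_weakEquivalence L j
  have : IsIso (L.map f') := by
    have : IsIso (L.map f' ≫ L.map y) := by
      rw [← L.map_comp, fac, L.map_comp]
      infer_instance
    exact IsIso.of_isIso_comp_right _ (L.map y)
  have : IsIso (L.map p) := by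
    have : IsIso (L.map i ≫ L.map p) := by
      rw [← L.map_comp, fac', L.map_comp]
      infer_instance
    exact IsIso.of_isIso_comp_left (L.map i) _
  have := weakEquivalence_of_isIso_map_of_fibration L p
  have : WeakEquivalence (f' ≫ j) := by
    rw [← fac']
    infer_instance
  have := weakEquivalence_of_postcomp f' j
  have : WeakEquivalence (x ≫ f) := by
    rw [← fac]
    infer_instance
  exact weakEquivalence_of_precomp x f

end Saturation

/-- Part of the two-out-of-six property of weak equivalences. -/
lemma weakEquivalence_of_comp_of_comp {X Y Z T : C} (f : X ⟶ Y) (g : Y ⟶ Z) (h : Z ⟶ T)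
    [WeakEquivalence (f ≫ g)] [WeakEquivalence (g ≫ h)] : WeakEquivalence h := by
  let L := (weakEquivalences C).Q
  have hfg := isIso_map_of_weakEquivalence L (f ≫ g)
  have hgh := isIso_map_of_weakEquivalence L (g ≫ h)
  rw [L.map_comp] at hfg hgh
  have : IsSplitEpi (L.map g) := ⟨⟨inv (L.map f ≫ L.map g) ≫ L.map f, by simp⟩⟩
  have : Mono (L.map g) := mono_of_mono (L.map g) (L.map h)
  have : IsIso (L.map g) := isIso_of_mono_of_isSplitEpi _
  rw [weakEquivalence_iff_isIso_map L]
  exact IsIso.of_isIso_comp_left (L.map g) _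

section Gluing

/-- The map induced on pushouts by a Reedy trivial cofibration of spans is
a trivial cofibration. -/
lemma trivialCofibrations_of_isPushout {A X B P A' X' B' P' : C}
    {f : A ⟶ X} {g : A ⟶ B} {inl : X ⟶ P} {inr : B ⟶ P} (sq : IsPushout f g inl inr)
    {f' : A' ⟶ X'} {g' : A' ⟶ B'} {inl' : X' ⟶ P'} {inr' : B' ⟶ P'}
    (sq' : IsPushout f' g' inl' inr') {a : A ⟶ A'} {x : X ⟶ X'} {b : B ⟶ B'}
    (hf : f ≫ x = a ≫ f') (hg : g ≫ b = a ≫ g') (ha : trivialCofibrations C a)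
    (hx : trivialCofibrations C (pushout.desc x f' hf))
    (hb : trivialCofibrations C (pushout.desc b g' hg))
    {p : P ⟶ P'} (hl : inl ≫ p = x ≫ inl') (hr : inr ≫ p = b ≫ inr') :
    trivialCofibrations C p := by
  rw [← fibrations_llp] at ha hx hb ⊢
  intro E F π hπ
  have := ha π hπ
  have := hx π hπ
  have := hb π hπ
  refine ⟨fun {u v} comm ↦ ?_⟩
  have sqA : CommSq (f ≫ inl ≫ u) a π (f' ≫ inl' ≫ v) :=
    ⟨by simp [comm.w, reassoc_of% hl, reassoc_of% hf]⟩
  have sqX : CommSq (pushout.desc (inl ≫ u) sqA.lift (by simp))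
      (pushout.desc x f' hf) π (inl' ≫ v) := by
    constructor
    ext
    · simp [comm.w, reassoc_of% hl]
    · simp
  have sqB : CommSq (pushout.desc (inr ≫ u) sqA.lift (by simp [← sq.w_assoc]))
      (pushout.desc b g' hg) π (inr' ≫ v) := by
    constructor
    ext
    · simp [comm.w, reassoc_of% hr]
    · simp [sq'.w_assoc]
  have hX₁ : x ≫ sqX.lift = inl ≫ u := by
    simpa only [pushout.inl_desc, pushout.inl_desc_assoc] using pushout.inl f a ≫= sqX.fac_left
  have hX₂ : f' ≫ sqX.lift = sqA.lift := by
    simpa only [pushout.inr_desc, pushout.inr_desc_assoc] using pushout.inr f a ≫= sqX.fac_left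
  have hB₁ : b ≫ sqB.lift = inr ≫ u := by
    simpa only [pushout.inl_desc, pushout.inl_desc_assoc] using pushout.inl g a ≫= sqB.fac_left
  have hB₂ : g' ≫ sqB.lift = sqA.lift := by
    simpa only [pushout.inr_desc, pushout.inr_desc_assoc] using pushout.inr g a ≫= sqB.fac_left
  refine ⟨⟨⟨sq'.desc sqX.lift sqB.lift (by rw [hX₂, hB₂]), ?_, ?_⟩⟩⟩
  · apply sq.hom_ext
    · rw [reassoc_of% hl, sq'.inl_desc, hX₁]
    · rw [reassoc_of% hr, sq'.inr_desc, hB₁]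
  · apply sq'.hom_ext
    · simp
    · simp

/-- A relative version of the factorization lemma of Ken Brown. -/
lemma exists_relative_brown_factorization {A X A' X' T : C} {f : A ⟶ X} {f' : A' ⟶ X'}
    [Cofibration f] [Cofibration f'] {a : A ⟶ A'} {x : X ⟶ X'} [WeakEquivalence x]
    (w : f ≫ x = a ≫ f') (i₀ : A ⟶ T) (i₁ : A' ⟶ T) (p : T ⟶ A')
    [Cofibration i₀] [WeakEquivalence i₀] [Cofibration i₁] [WeakEquivalence i₁]
    (h₀ : i₀ ≫ p = a) (h₁ : i₁ ≫ p = 𝟙 A') :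
    ∃ (U : C) (t : T ⟶ U) (j₀ : X ⟶ U) (j₁ : X' ⟶ U) (q : U ⟶ X')
      (w₀ : f ≫ j₀ = i₀ ≫ t) (w₁ : f' ≫ j₁ = i₁ ≫ t),
      trivialCofibrations C (pushout.desc j₀ t w₀) ∧
      trivialCofibrations C (pushout.desc j₁ t w₁) ∧
      j₀ ≫ q = x ∧ j₁ ≫ q = 𝟙 X' ∧ t ≫ q = p ≫ f' := by
  let φ₀ : pushout f i₀ ⟶ X' := pushout.desc x (p ≫ f') (by rw [w, reassoc_of% h₀])
  let φ₁ : pushout f' i₁ ⟶ X' := pushout.desc (𝟙 X') (p ≫ f') (by simp [reassoc_of% h₁])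
  obtain ⟨U, k, q, _, _, _, fac⟩ := exists_cofibration_trivialFibration
    (pushout.desc (f := pushout.inr f i₀) (g := pushout.inr f' i₁) φ₀ φ₁ (by simp [φ₀, φ₁]))
  let k₀ : pushout f i₀ ⟶ U := pushout.inl _ _ ≫ k
  let k₁ : pushout f' i₁ ⟶ U := pushout.inr _ _ ≫ k
  have hk₀ : k₀ ≫ q = φ₀ := by simp [k₀, fac]
  have hk₁ : k₁ ≫ q = φ₁ := by simp [k₁, fac]
  have hk : pushout.inr f i₀ ≫ k₀ = pushout.inr f' i₁ ≫ k₁ := by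
    simp only [k₀, k₁, pushout.condition_assoc]
  have hx : (pushout.inl f i₀ ≫ k₀) ≫ q = x := by simp [hk₀, φ₀]
  have hx' : (pushout.inl f' i₁ ≫ k₁) ≫ q = 𝟙 X' := by simp [hk₁, φ₁]
  have : WeakEquivalence (pushout.inl f i₀ ≫ k₀) := weakEquivalence_of_postcomp_of_fac hx
  have : WeakEquivalence (pushout.inl f' i₁ ≫ k₁) := weakEquivalence_of_postcomp_of_fac hx'
  have : WeakEquivalence k₀ := weakEquivalence_of_precomp (pushout.inl f i₀) k₀
  have : WeakEquivalence k₁ := weakEquivalence_of_precomp (pushout.inl f' i₁) k₁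
  have : Cofibration k₀ := by dsimp only [k₀]; infer_instance
  have : Cofibration k₁ := by dsimp only [k₁]; infer_instance
  refine ⟨U, pushout.inr f i₀ ≫ k₀, pushout.inl f i₀ ≫ k₀, pushout.inl f' i₁ ≫ k₁, q,
    by rw [pushout.condition_assoc], by rw [pushout.condition_assoc, hk], ?_, ?_, hx, hx', ?_⟩
  · convert! mem_trivialCofibrations k₀
    ext <;> simp
  · convert! mem_trivialCofibrations k₁
    ext <;> simp [hk]
  · simp [hk₀, φ₀]

/-- The gluing lemma, for spans of cofibrations between cofibrant objects. -/
lemma weakEquivalence_of_isPushout {A X B P A' X' B' P' : C}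
    [IsCofibrant A] [IsCofibrant A']
    {f : A ⟶ X} {g : A ⟶ B} {inl : X ⟶ P} {inr : B ⟶ P} (sq : IsPushout f g inl inr)
    {f' : A' ⟶ X'} {g' : A' ⟶ B'} {inl' : X' ⟶ P'} {inr' : B' ⟶ P'}
    (sq' : IsPushout f' g' inl' inr')
    [Cofibration f] [Cofibration g] [Cofibration f'] [Cofibration g']
    {a : A ⟶ A'} {x : X ⟶ X'} {b : B ⟶ B'}
    [WeakEquivalence a] [WeakEquivalence x] [WeakEquivalence b]
    (hf : f ≫ x = a ≫ f') (hg : g ≫ b = a ≫ g')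
    {p : P ⟶ P'} (hl : inl ≫ p = x ≫ inl') (hr : inr ≫ p = b ≫ inr') :
    WeakEquivalence p := by
  obtain ⟨T, i, π, _, _, _, fac⟩ :=
    exists_cofibration_trivialFibration (coprod.desc a (𝟙 A'))
  have h₀ : (coprod.inl ≫ i) ≫ π = a := by simp [fac]
  have h₁ : (coprod.inr ≫ i) ≫ π = 𝟙 A' := by simp [fac]
  have := weakEquivalence_of_postcomp_of_fac h₀
  have := weakEquivalence_of_postcomp_of_fac h₁
  obtain ⟨U, t, j₀, j₁, q, w₀, w₁, hj₀, hj₁, hq₀, hq₁, hq⟩ :=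
    exists_relative_brown_factorization hf _ _ π h₀ h₁
  obtain ⟨V, s, k₀, k₁, r, z₀, z₁, hk₀, hk₁, hr₀, hr₁, hr'⟩ :=
    exists_relative_brown_factorization hg _ _ π h₀ h₁
  let p₀ : P ⟶ pushout t s := sq.desc (j₀ ≫ pushout.inl _ _) (k₀ ≫ pushout.inr _ _)
    (by rw [reassoc_of% w₀, reassoc_of% z₀, pushout.condition])
  let p₁ : P' ⟶ pushout t s := sq'.desc (j₁ ≫ pushout.inl _ _) (k₁ ≫ pushout.inr _ _)
    (by rw [reassoc_of% w₁, reassoc_of% z₁, pushout.condition])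
  have hp₀ : trivialCofibrations C p₀ :=
    trivialCofibrations_of_isPushout sq (.of_hasPushout t s) w₀ z₀
      (mem_trivialCofibrations _) hj₀ hk₀ (by simp [p₀]) (by simp [p₀])
  have hp₁ : trivialCofibrations C p₁ :=
    trivialCofibrations_of_isPushout sq' (.of_hasPushout t s) w₁ z₁
      (mem_trivialCofibrations _) hj₁ hk₁ (by simp [p₁]) (by simp [p₁])
  let ρ : pushout t s ⟶ P' := pushout.desc (q ≫ inl') (r ≫ inr')
    (by rw [reassoc_of% hq, reassoc_of% hr', sq'.w])
  have hρ₀ : p₀ ≫ ρ = p := by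
    apply sq.hom_ext
    · simp [p₀, ρ, reassoc_of% hq₀, hl]
    · simp [p₀, ρ, reassoc_of% hr₀, hr]
  have hρ₁ : p₁ ≫ ρ = 𝟙 P' := by
    apply sq'.hom_ext
    · simp [p₁, ρ, reassoc_of% hq₁]
    · simp [p₁, ρ, reassoc_of% hr₁]
  obtain ⟨_, _⟩ := (mem_trivialCofibrations_iff p₀).1 hp₀
  obtain ⟨_, _⟩ := (mem_trivialCofibrations_iff p₁).1 hp₁
  have : WeakEquivalence ρ := weakEquivalence_of_precomp_of_fac hρ₁
  rw [← hρ₀]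
  infer_instance

end Gluing

end

end HomotopicalAlgebra

namespace ModelStructure

open HomotopicalAlgebra

lemma isRetractOfMaps_of_retractArrow {C : Type u} [Category.{v} C] {X Y X' Y' : C}
    {f : X ⟶ Y} {g : X' ⟶ Y'} (h : RetractArrow f g) : IsRetractOfMaps f g :=
  ⟨h.i.left, h.r.left, h.i.right, h.r.right, h.retract_left, h.retract_right, h.i_w, h.r_w.symm⟩

variable {C : Type u} [Category.{v} C] [HasFiniteLimits C] [HasFiniteColimits C]

/-- The model category attached to a closed model structure. -/
@[reducible]
def modelCategory (M : ModelStructure C) : ModelCategory C where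
  categoryWithFibrations := ⟨M.Fib⟩
  categoryWithCofibrations := ⟨M.Cof⟩
  categoryWithWeakEquivalences := ⟨M.W⟩
  cm2 :=
    { comp_mem := M.W_comp
      of_postcomp := M.W_of_comp_right
      of_precomp := M.W_of_comp_left }
  cm3a := ⟨fun h hg ↦ M.W_retract _ _ (isRetractOfMaps_of_retractArrow h) hg⟩
  cm3b := ⟨fun h hg ↦ M.Fib_retract _ _ (isRetractOfMaps_of_retractArrow h) hg⟩
  cm3c := ⟨fun h hg ↦ M.Cof_retract _ _ (isRetractOfMaps_of_retractArrow h) hg⟩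
  cm4a i p hi hi' hp := M.lifting i p hi.mem hp.mem (Or.inl hi'.mem)
  cm4b i p hi hp hp' := M.lifting i p hi.mem hp.mem (Or.inr hp'.mem)
  cm5a := ⟨fun f ↦ by
    obtain ⟨Z, i, p, hi, hi', hp, fac⟩ := M.fact_trivCof_fib f
    exact ⟨⟨Z, i, p, fac, ⟨hi, hi'⟩, hp⟩⟩⟩
  cm5b := ⟨fun f ↦ by
    obtain ⟨Z, i, p, hi, hp, hp', fac⟩ := M.fact_cof_trivFib f
    exact ⟨⟨Z, i, p, fac, hi, ⟨hp, hp'⟩⟩⟩⟩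

lemma W_of_comp_of_comp (M : ModelStructure C) {X Y Z T : C} {f : X ⟶ Y} {g : Y ⟶ Z}
    {h : Z ⟶ T} (hfg : M.W (f ≫ g)) (hgh : M.W (g ≫ h)) : M.W h := by
  letI := M.modelCategory
  have : WeakEquivalence (f ≫ g) := ⟨hfg⟩
  have : WeakEquivalence (g ≫ h) := ⟨hgh⟩
  exact (weakEquivalence_of_comp_of_comp f g h).mem

/-- A span of cofibrations out of a cofibrant object. -/
structure IsCofibrantSpan (M : ModelStructure C) {A X B : C} (f : A ⟶ X) (g : A ⟶ B) :
    Prop where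
  cofibrant : M.Cofibrant A
  cof_left : M.Cof f
  cof_right : M.Cof g

lemma W_of_isPushout (M : ModelStructure C) {A X B P A' X' B' P' : C}
    {f : A ⟶ X} {g : A ⟶ B} {inl : X ⟶ P} {inr : B ⟶ P} (sq : IsPushout f g inl inr)
    {f' : A' ⟶ X'} {g' : A' ⟶ B'} {inl' : X' ⟶ P'} {inr' : B' ⟶ P'}
    (sq' : IsPushout f' g' inl' inr')
    (h : M.IsCofibrantSpan f g) (h' : M.IsCofibrantSpan f' g')
    {a : A ⟶ A'} {x : X ⟶ X'} {b : B ⟶ B'} (ha : M.W a) (hx : M.W x) (hb : M.W b)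
    (hf : f ≫ x = a ≫ f') (hg : g ≫ b = a ≫ g')
    {p : P ⟶ P'} (hl : inl ≫ p = x ≫ inl') (hr : inr ≫ p = b ≫ inr') : M.W p := by
  letI := M.modelCategory
  have : IsCofibrant A := ⟨h.cofibrant⟩
  have : IsCofibrant A' := ⟨h'.cofibrant⟩
  have : Cofibration f := ⟨h.cof_left⟩
  have : Cofibration g := ⟨h.cof_right⟩
  have : Cofibration f' := ⟨h'.cof_left⟩
  have : Cofibration g' := ⟨h'.cof_right⟩
  have : WeakEquivalence a := ⟨ha⟩
  have : WeakEquivalence x := ⟨hx⟩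
  have : WeakEquivalence b := ⟨hb⟩
  exact (weakEquivalence_of_isPushout sq sq' hf hg hl hr).mem

lemma exists_isCofibrantSpan (M : ModelStructure C) {A X B : C} (f : A ⟶ X) (g : A ⟶ B) :
    ∃ (A' X' B' : C) (f' : A' ⟶ X') (g' : A' ⟶ B') (a : A' ⟶ A) (x : X' ⟶ X) (b : B' ⟶ B),
      M.IsCofibrantSpan f' g' ∧ M.W a ∧ M.W x ∧ M.W b ∧ f' ≫ x = a ≫ f ∧ g' ≫ b = a ≫ g := by
  obtain ⟨A', i, a, hi, _, ha, _⟩ := M.fact_cof_trivFib (initial.to A)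
  obtain ⟨X', f', x, hf', _, hx, hf⟩ := M.fact_cof_trivFib (a ≫ f)
  obtain ⟨B', g', b, hg', _, hb, hg⟩ := M.fact_cof_trivFib (a ≫ g)
  obtain rfl := Subsingleton.elim (initial.to A') i
  exact ⟨A', X', B', f', g', a, x, b, ⟨hi, hf', hg'⟩, ha, hx, hb, hf, hg⟩

end ModelStructure

attribute [local simp] pushout.inl_desc pushout.inl_desc_assoc pushout.inr_desc
  pushout.inr_desc_assoc in
lemma IsHomotopyCocartesian.of_weakEquivalences_eq {C : Type u} [Category.{v} C]
    [HasFiniteLimits C] [HasFiniteColimits C] {M₁ M₂ : ModelStructure C} (hW : M₁.W = M₂.W)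
    {A B X Y : C} {f : A ⟶ X} {g : A ⟶ B} {g' : X ⟶ Y} {f' : B ⟶ Y}
    (h : IsHomotopyCocartesian M₁ f g g' f') : IsHomotopyCocartesian M₂ f g g' f' := by
  obtain ⟨A₁, X₁, B₁, f₁, g₁, a₁, x₁, b₁, hA₁, hf₁, hg₁, ha₁, hx₁, hb₁, wf₁, wg₁,
    P₁, inl₁, inr₁, sq₁, q, hq, hl₁, hr₁⟩ := h
  obtain ⟨A₂, X₂, B₂, f₂, g₂, a₂, x₂, b₂, h₂, ha₂, hx₂, hb₂, wf₂, wg₂⟩ :=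
    M₂.exists_isCofibrantSpan f₁ g₁
  obtain ⟨A₃, X₃, B₃, f₃, g₃, a₃, x₃, b₃, h₃, ha₃, hx₃, hb₃, wf₃, wg₃⟩ :=
    M₁.exists_isCofibrantSpan f₂ g₂
  obtain ⟨A₄, X₄, B₄, f₄, g₄, a₄, x₄, b₄, h₄, ha₄, hx₄, hb₄, wf₄, wg₄⟩ :=
    M₂.exists_isCofibrantSpan f₃ g₃
  let p₂ : pushout f₂ g₂ ⟶ P₁ := pushout.desc (x₂ ≫ inl₁) (b₂ ≫ inr₁)
    (by rw [reassoc_of% wf₂, reassoc_of% wg₂, sq₁.w])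
  let p₃ : pushout f₃ g₃ ⟶ pushout f₂ g₂ := pushout.map _ _ _ _ x₃ b₃ a₃ wf₃ wg₃
  let p₄ : pushout f₄ g₄ ⟶ pushout f₃ g₃ := pushout.map _ _ _ _ x₄ b₄ a₄ wf₄ wg₄
  rw [← hW] at ha₂ hx₂ hb₂
  have h₃₁ : M₁.W (p₃ ≫ p₂) :=
    M₁.W_of_isPushout (.of_hasPushout f₃ g₃) sq₁ h₃ ⟨hA₁, hf₁, hg₁⟩
      (M₁.W_comp _ _ ha₃ ha₂) (M₁.W_comp _ _ hx₃ hx₂) (M₁.W_comp _ _ hb₃ hb₂)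
      (by simp [reassoc_of% wf₃, wf₂]) (by simp [reassoc_of% wg₃, wg₂])
      (by simp [p₃, p₂]) (by simp [p₃, p₂])
  have h₄₂ : M₁.W (p₄ ≫ p₃) := by
    rw [hW] at ha₃ hx₃ hb₃ ⊢
    exact M₂.W_of_isPushout (.of_hasPushout f₄ g₄) (.of_hasPushout f₂ g₂) h₄ h₂
      (M₂.W_comp _ _ ha₄ ha₃) (M₂.W_comp _ _ hx₄ hx₃) (M₂.W_comp _ _ hb₄ hb₃)
      (by simp [reassoc_of% wf₄, wf₃]) (by simp [reassoc_of% wg₄, wg₃])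
      (by simp [p₄, p₃]) (by simp [p₄, p₃])
  have hp₂ : M₁.W p₂ := M₁.W_of_comp_of_comp h₄₂ h₃₁
  refine ⟨A₂, X₂, B₂, f₂, g₂, a₂ ≫ a₁, x₂ ≫ x₁, b₂ ≫ b₁, h₂.cofibrant, h₂.cof_left,
    h₂.cof_right, ?_⟩
  rw [← hW]
  exact ⟨M₁.W_comp _ _ ha₂ ha₁, M₁.W_comp _ _ hx₂ hx₁, M₁.W_comp _ _ hb₂ hb₁,
    by simp [reassoc_of% wf₂, wf₁], by simp [reassoc_of% wg₂, wg₁],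
    pushout f₂ g₂, pushout.inl _ _, pushout.inr _ _, .of_hasPushout f₂ g₂,
    p₂ ≫ q, M₁.W_comp _ _ hp₂ hq, by simp [p₂, hl₁], by simp [p₂, hr₁]⟩

/-- If two closed model structures on a category `C` have the same weak
equivalences, then a commutative square is homotopy cocartesian with respect to the first
model structure iff it is so with respect to the second. -/
theorem isHomotopyCocartesian_iff_of_weakEquivalences_eq
    {C : Type u} [Category.{v} C] [HasInitial C] [HasFiniteLimits C] [HasFiniteColimits C]
    (M₁ M₂ : ModelStructure C) (hW : M₁.W = M₂.W)
    {A B X Y : C} (f : A ⟶ X) (g : A ⟶ B) (g' : X ⟶ Y) (f' : B ⟶ Y)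
    (hcomm : f ≫ g' = g ≫ f') :
    IsHomotopyCocartesian M₁ f g g' f' ↔ IsHomotopyCocartesian M₂ f g g' f' :=
  ⟨fun h ↦ h.of_weakEquivalences_eq hW, fun h ↦ h.of_weakEquivalences_eq hW.symm⟩
end

section
/- Let C be a closed model category with all small coproducts. Let {X_α} be a set of cofibrant objects of C and let X be their coproduct in C, with coprojections ι_α : X_α → X. Then the images of the ι_α under the localization functor C → Ho(C), where Ho(C) is the localization of C at the class of weak equivalences, exhibit the image of X as a coproduct of the images of the X_α in Ho(C). -/
open CategoryTheory CategoryTheory.Limits Opposite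

universe w v u

variable {C : Type u} [Category.{v} C]

lemma CategoryTheory.RetractArrow.isRetractOfMaps {X Y X' Y' : C} {f : X ⟶ Y} {g : X' ⟶ Y'}
    (h : RetractArrow f g) : IsRetractOfMaps f g :=
  ⟨h.left.i, h.left.r, h.right.i, h.right.r, h.left.retract, h.right.retract, h.i_w, h.r_w.symm⟩

open HomotopicalAlgebra in
/-- A closed model structure on a finitely complete and finitely cocomplete category gives rise to
Mathlib's `ModelCategory`. -/
@[reducible]
def ModelStructure.toModelCategory [HasFiniteLimits C] [HasFiniteColimits C]
    (M : ModelStructure C) : ModelCategory C :=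
  { categoryWithFibrations := ⟨M.Fib⟩
    categoryWithCofibrations := ⟨M.Cof⟩
    categoryWithWeakEquivalences := ⟨M.W⟩
    cm2 :=
      { comp_mem := fun f g hf hg => M.W_comp f g hf hg
        of_postcomp := fun f g hg hfg => M.W_of_comp_right f g hg hfg
        of_precomp := fun f g hf hfg => M.W_of_comp_left f g hf hfg }
    cm3a := ⟨fun h hg => M.W_retract _ _ h.isRetractOfMaps hg⟩
    cm3b := ⟨fun h hg => M.Fib_retract _ _ h.isRetractOfMaps hg⟩
    cm3c := ⟨fun h hg => M.Cof_retract _ _ h.isRetractOfMaps hg⟩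
    cm4a := fun i p hi hw hp => M.lifting i p hi.mem hp.mem (Or.inl hw.mem)
    cm4b := fun i p hi hp hw => M.lifting i p hi.mem hp.mem (Or.inr hw.mem)
    cm5a := ⟨fun f => by
      obtain ⟨Z, i, p, hi, hw, hp, fac⟩ := M.fact_trivCof_fib f
      exact ⟨⟨Z, i, p, fac, ⟨hi, hw⟩, hp⟩⟩⟩
    cm5b := ⟨fun f => by
      obtain ⟨Z, i, p, hi, hp, hw, fac⟩ := M.fact_cof_trivFib f
      exact ⟨⟨Z, i, p, fac, hi, ⟨hp, hw⟩⟩⟩⟩ }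

namespace HomotopicalAlgebra

section Coproduct

variable [ModelCategory C] {ι : Type w} (X : ι → C) [HasCoproduct X]

instance isCofibrant_sigma [∀ i, IsCofibrant (X i)] : IsCofibrant (∐ X) := by
  rw [isCofibrant_iff, cofibration_iff,
    ← MorphismProperty.llp_eq_of_wfs (cofibrations C) (trivialFibrations C)]
  intro A B p hp
  obtain ⟨_, _⟩ := (mem_trivialFibrations_iff p).1 hp
  refine ⟨fun {f g} sq => ?_⟩
  have sq' (i : ι) : CommSq (initial.to A) (initial.to (X i)) p (Sigma.ι X i ≫ g) :=
    ⟨Subsingleton.elim _ _⟩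
  exact ⟨⟨{ l := Sigma.desc fun i => (sq' i).lift
            fac_left := Subsingleton.elim _ _
            fac_right := by ext i; simp }⟩⟩

lemma RightHomotopyRel.of_sigma_ι {Y : C} [∀ i, IsCofibrant (X i)] [IsFibrant Y]
    {f g : ∐ X ⟶ Y}
    (h : ∀ i, RightHomotopyRel (Sigma.ι X i ≫ f) (Sigma.ι X i ≫ g)) :
    RightHomotopyRel f g := by
  obtain ⟨P, _⟩ := PathObject.exists_very_good Y
  let H (i : ι) := (h i).rightHomotopy P
  exact ⟨P, ⟨{ h := Sigma.desc fun i => (H i).h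
               h₀ := by ext i; simp [(H i).h₀]
               h₁ := by ext i; simp [(H i).h₁] }⟩⟩

variable {H : Type*} [Category* H] (L : C ⥤ H) [L.IsLocalization (weakEquivalences C)]

lemma exists_isFibrant_iso_of_isLocalization (Z : H) :
    ∃ (Y : C) (_ : IsFibrant Y), Nonempty (L.obj Y ≅ Z) := by
  have := Localization.essSurj L (weakEquivalences C)
  let i := FibrantObject.HoCat.iResolutionObj (L.objPreimage Z)
  have : IsIso (L.map i) := Localization.inverts L (weakEquivalences C) i (mem_weakEquivalences i)
  exact ⟨_, inferInstance, ⟨(asIso (L.map i)).symm ≪≫ L.objObjPreimageIso Z⟩⟩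

variable [∀ i, IsCofibrant (X i)]

lemma exists_desc_of_isLocalization {Z : H} (φ : ∀ i, L.obj (X i) ⟶ Z) :
    ∃ ψ : L.obj (∐ X) ⟶ Z, ∀ i, L.map (Sigma.ι X i) ≫ ψ = φ i := by
  obtain ⟨Y, _, ⟨e⟩⟩ := exists_isFibrant_iso_of_isLocalization L Z
  choose f hf using fun i => map_surjective_of_isLocalization L (X i) Y (φ i ≫ e.inv)
  refine ⟨L.map (Sigma.desc f) ≫ e.hom, fun i => ?_⟩
  rw [← L.map_comp_assoc, Sigma.ι_desc, hf, Category.assoc, e.inv_hom_id, Category.comp_id]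

lemma sigma_hom_ext_of_isLocalization {Z : H} {φ ψ : L.obj (∐ X) ⟶ Z}
    (h : ∀ i, L.map (Sigma.ι X i) ≫ φ = L.map (Sigma.ι X i) ≫ ψ) : φ = ψ := by
  obtain ⟨Y, _, ⟨e⟩⟩ := exists_isFibrant_iso_of_isLocalization L Z
  obtain ⟨f, hf⟩ := map_surjective_of_isLocalization L (∐ X) Y (φ ≫ e.inv)
  obtain ⟨g, hg⟩ := map_surjective_of_isLocalization L (∐ X) Y (ψ ≫ e.inv)
  rw [← cancel_mono e.inv, ← hf, ← hg, ← RightHomotopyRel.iff_map_eq]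
  refine RightHomotopyRel.of_sigma_ι X fun i => ?_
  rw [RightHomotopyRel.iff_map_eq L, L.map_comp, L.map_comp, hf, hg, ← Category.assoc, h i, Category.assoc]

/-- A localization functor at the weak equivalences preserves coproducts of cofibrant objects. -/
noncomputable def isColimitCofanOfIsLocalization :
    IsColimit (Cofan.mk (f := fun i => L.obj (X i)) (L.obj (∐ X))
      (fun i => L.map (Sigma.ι X i))) :=
  Cofan.IsColimit.mk _
    (fun s => (exists_desc_of_isLocalization X L s.inj).choose)
    (fun s => (exists_desc_of_isLocalization X L s.inj).choose_spec)
    (fun s _ hm => sigma_hom_ext_of_isLocalization X L fun i =>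
      (hm i).trans ((exists_desc_of_isLocalization X L s.inj).choose_spec i).symm)

end Coproduct

end HomotopicalAlgebra

/-- In a closed model category with all small coproducts, the coproduct
of a family of cofibrant objects, together with the images of the coprojections under the
localization functor `C ⥤ Ho(C)` at the weak equivalences, is a coproduct of the images
in the homotopy category `Ho(C)`. -/
theorem coproduct_of_cofibrant_isCoproduct_in_localization
    {C : Type u} [Category.{v} C] [HasInitial C] [HasFiniteLimits C] [HasColimits C]
    (M : ModelStructure C) {ι : Type v} (Xs : ι → C)
    (hcof : ∀ i, M.Cofibrant (Xs i)) :
    Nonempty (IsColimit (Cofan.mk (f := fun i => M.W.Q.obj (Xs i))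
      (M.W.Q.obj (∐ Xs)) (fun i => M.W.Q.map (Sigma.ι Xs i)))) := by
  let := M.toModelCategory
  have (i : ι) : HomotopicalAlgebra.IsCofibrant (Xs i) := ⟨hcof i⟩
  have : M.W.Q.IsLocalization (HomotopicalAlgebra.weakEquivalences C) :=
    inferInstanceAs (M.W.Q.IsLocalization M.W)
  exact ⟨HomotopicalAlgebra.isColimitCofanOfIsLocalization Xs M.W.Q⟩
end
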